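/- There exists C > 0 such that for any f ∈ H¹(ℝ²), any g ∈ Ḣ⁻¹(ℝ²) ∩ L∞(ℝ²) with ‖g‖_{Ḣ⁻¹} ≤ 1/2, and any ε ∈ (0,1/2], one has |∫_{ℝ²} g f² dx| ≤ C(‖g‖_{Ḣ⁻¹}|ln ε|^{1/2} + ε‖g‖_{L∞}) ‖f‖²_{H¹}. -/

import Mathlib

open MeasureTheory

lemma ENNReal.add_sq_le_two_mul (a b : ENNReal) : (a + b) ^ 2 ≤ 2 * (a ^ 2 + b ^ 2) := by
  have h := ENNReal.rpow_add_le_mul_rpow_add_rpow a b (p := 2) (by norm_num)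
  norm_num at h
  exact h

lemma Real.enorm_sq_eq_ofReal_sq (r : ℝ) : ‖r‖ₑ ^ 2 = ENNReal.ofReal (r ^ 2) := by
  rw [← ofReal_norm, ← ENNReal.ofReal_pow (norm_nonneg _), Real.norm_eq_abs, sq_abs]

lemma ENNReal.sq_lintegral_mul_le {α : Type*} [MeasurableSpace α] (μ : Measure α)
    {u v : α → ENNReal} (hu : AEMeasurable u μ) (hv : AEMeasurable v μ) :
    (∫⁻ a, u a * v a ∂μ) ^ 2 ≤ (∫⁻ a, u a ^ 2 ∂μ) * ∫⁻ a, v a ^ 2 ∂μ := by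
  have h := ENNReal.lintegral_mul_le_Lp_mul_Lq μ Real.HolderConjugate.two_two hu hv
  calc (∫⁻ a, u a * v a ∂μ) ^ 2
      ≤ ((∫⁻ a, u a ^ (2 : ℝ) ∂μ) ^ (1 / 2 : ℝ) * (∫⁻ a, v a ^ (2 : ℝ) ∂μ) ^ (1 / 2 : ℝ)) ^ 2 := by
        gcongr
        exact h
    _ = _ := by
        rw [mul_pow, ← ENNReal.rpow_natCast, ← ENNReal.rpow_mul, ← ENNReal.rpow_natCast,
          ← ENNReal.rpow_mul]
        norm_num

lemma ENNReal.sq_lintegral_le {α : Type*} [MeasurableSpace α] (μ : Measure α)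
    [IsProbabilityMeasure μ] {u : α → ENNReal} (hu : AEMeasurable u μ) :
    (∫⁻ a, u a ∂μ) ^ 2 ≤ ∫⁻ a, u a ^ 2 ∂μ := by
  simpa using ENNReal.sq_lintegral_mul_le μ hu (aemeasurable_const (b := 1))

section Mollify

variable {V : Type*} [NormedAddCommGroup V] [NormedSpace ℝ V] [MeasurableSpace V] [BorelSpace V]

/-- A function differentiable along a ray varies by at most the integral of the norm of its
derivative, with no integrability requirement. -/
lemma enorm_sub_le_lintegral_fderiv {f : V → ℝ} (hf : Differentiable ℝ f) (x z : V) {a b : ℝ}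
    (hab : a ≤ b) :
    ‖f (x - b • z) - f (x - a • z)‖ₑ ≤
      ∫⁻ s in Set.Ioc a b, ‖fderiv ℝ f (x - s • z)‖ₑ * ‖z‖ₑ := by
  have hd : ∀ s : ℝ, HasDerivAt (fun s : ℝ => f (x - s • z)) (fderiv ℝ f (x - s • z) (-z)) s := by
    intro s
    refine (hf (x - s • z)).hasFDerivAt.comp_hasDerivAt s ?_
    simpa using ((hasDerivAt_id s).smul_const z).const_sub x
  have hle : ∀ s : ℝ, ‖fderiv ℝ f (x - s • z) (-z)‖ₑ ≤ ‖fderiv ℝ f (x - s • z)‖ₑ * ‖z‖ₑ := by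
    intro s
    simpa using (fderiv ℝ f (x - s • z)).le_opENorm (-z)
  by_cases hfin : ∫⁻ s in Set.Ioc a b, ‖fderiv ℝ f (x - s • z)‖ₑ * ‖z‖ₑ = ⊤
  · rw [hfin]; exact le_top
  have hm : Measurable fun s : ℝ => fderiv ℝ f (x - s • z) (-z) :=
    (measurable_fderiv_apply_const ℝ f (-z)).comp (by fun_prop)
  have hint : IntervalIntegrable (fun s : ℝ => fderiv ℝ f (x - s • z) (-z)) volume a b := by
    rw [intervalIntegrable_iff_integrableOn_Ioc_of_le hab]
    exact ⟨hm.aestronglyMeasurable,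
      (lintegral_mono hle).trans_lt (lt_top_iff_ne_top.2 hfin)⟩
  rw [← intervalIntegral.integral_eq_sub_of_hasDerivAt (fun s _ => hd s) hint,
    intervalIntegral.integral_of_le hab]
  exact (enorm_integral_le_lintegral_enorm _).trans (lintegral_mono hle)

/-- The average of the dilated translates `x ↦ f (x - ε • z)` with respect to `μ`. -/
noncomputable def mollify (μ : Measure V) (ε : ℝ) (f : V → ℝ) (x : V) : ℝ :=
  ∫ z, f (x - ε • z) ∂μ

variable {μ : Measure V} [IsProbabilityMeasure μ] {f : V → ℝ} {ε : ℝ}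

lemma integrable_comp_sub_smul (hf : Continuous f) (hfc : HasCompactSupport f) (ε : ℝ) (x : V) :
    Integrable (fun z => f (x - ε • z)) μ := by
  obtain ⟨K, hK⟩ := hf.bounded_above_of_compact_support hfc
  exact Integrable.of_bound (hf.comp (by fun_prop)).aestronglyMeasurable K
    (ae_of_all _ fun _ => hK _)

lemma enorm_mollify_sq_le (hf : Continuous f) (x : V) :
    ‖mollify μ ε f x‖ₑ ^ 2 ≤ ∫⁻ z, ‖f (x - ε • z)‖ₑ ^ 2 ∂μ :=
  (pow_le_pow_left' (enorm_integral_le_lintegral_enorm _) 2).trans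
    (ENNReal.sq_lintegral_le _ (hf.comp (by fun_prop)).enorm.measurable.aemeasurable)

variable [FiniteDimensional ℝ V]

lemma lintegral_sq_translate_sub_le {ν : Measure V} [SFinite ν] [ν.IsAddRightInvariant]
    {f : V → ℝ}
    (hf : Differentiable ℝ f) (w : V) :
    ∫⁻ x, ‖f (x - w) - f x‖ₑ ^ 2 ∂ν ≤ ‖w‖ₑ ^ 2 * ∫⁻ x, ‖fderiv ℝ f x‖ₑ ^ 2 ∂ν := by
  have hG : Measurable fun x => ‖fderiv ℝ f x‖ₑ := (measurable_fderiv ℝ f).enorm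
  have : IsProbabilityMeasure (volume.restrict (Set.Ioc (0 : ℝ) 1)) := ⟨by simp⟩
  calc ∫⁻ x, ‖f (x - w) - f x‖ₑ ^ 2 ∂ν
      ≤ ∫⁻ x, (∫⁻ s in Set.Ioc (0 : ℝ) 1, (‖fderiv ℝ f (x - s • w)‖ₑ * ‖w‖ₑ) ^ 2) ∂ν := by
        refine lintegral_mono fun x => ?_
        have h := enorm_sub_le_lintegral_fderiv hf x w zero_le_one
        simp only [one_smul, zero_smul, sub_zero] at h
        refine le_trans (by gcongr) (ENNReal.sq_lintegral_le _ ?_)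
        exact ((hG.comp (by fun_prop)).mul_const _).aemeasurable
    _ = ∫⁻ s in Set.Ioc (0 : ℝ) 1, ∫⁻ x, (‖fderiv ℝ f (x - s • w)‖ₑ * ‖w‖ₑ) ^ 2 ∂ν := by
        refine lintegral_lintegral_swap ?_
        exact (((hG.comp (by fun_prop)).mul_const _).pow_const 2).aemeasurable
    _ = ∫⁻ s in Set.Ioc (0 : ℝ) 1, ‖w‖ₑ ^ 2 * ∫⁻ x, ‖fderiv ℝ f x‖ₑ ^ 2 ∂ν := by
        refine lintegral_congr fun s => ?_
        simp_rw [mul_pow]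
        rw [lintegral_mul_const' _ _ (by simp),
          lintegral_sub_right_eq_self (fun x => ‖fderiv ℝ f x‖ₑ ^ 2), mul_comm]
    _ = _ := by simp

lemma lintegral_mollify_sq_le {ν : Measure V} [SFinite ν] [ν.IsAddRightInvariant]
    (hf : Continuous f) :
    ∫⁻ x, ‖mollify μ ε f x‖ₑ ^ 2 ∂ν ≤ ∫⁻ x, ‖f x‖ₑ ^ 2 ∂ν := by
  calc _ ≤ ∫⁻ x, ∫⁻ z, ‖f (x - ε • z)‖ₑ ^ 2 ∂μ ∂ν :=
        lintegral_mono fun x => enorm_mollify_sq_le hf x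
    _ = ∫⁻ z, ∫⁻ x, ‖f (x - ε • z)‖ₑ ^ 2 ∂ν ∂μ := by
        refine lintegral_lintegral_swap ?_
        exact (((hf.comp (by fun_prop)).enorm.measurable).pow_const 2).aemeasurable
    _ = _ := by
        simp [lintegral_sub_right_eq_self (fun x => ‖f x‖ₑ ^ 2)]

lemma lintegral_mollify_sub_sq_le {ν : Measure V} [SFinite ν] [ν.IsAddRightInvariant]
    (hf : Differentiable ℝ f) (hfc : HasCompactSupport f) (hμ : ∀ᵐ z ∂μ, ‖z‖ ≤ 1) :
    ∫⁻ x, ‖mollify μ ε f x - f x‖ₑ ^ 2 ∂ν ≤ ‖ε‖ₑ ^ 2 * ∫⁻ x, ‖fderiv ℝ f x‖ₑ ^ 2 ∂ν := by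
  have hc := hf.continuous
  calc _ ≤ ∫⁻ x, ∫⁻ z, ‖f (x - ε • z) - f x‖ₑ ^ 2 ∂μ ∂ν := by
        refine lintegral_mono fun x => ?_
        have : mollify μ ε f x - f x = ∫ z, (f (x - ε • z) - f x) ∂μ := by
          rw [integral_sub (integrable_comp_sub_smul hc hfc ε x) (integrable_const _)]
          simp [mollify]
        rw [this]
        refine (pow_le_pow_left' (enorm_integral_le_lintegral_enorm _) 2).trans
          (ENNReal.sq_lintegral_le _ ?_)
        exact ((hc.comp (by fun_prop)).sub continuous_const).enorm.measurable.aemeasurable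
    _ = ∫⁻ z, ∫⁻ x, ‖f (x - ε • z) - f x‖ₑ ^ 2 ∂ν ∂μ := by
        refine lintegral_lintegral_swap ?_
        exact ((((hc.comp (by fun_prop)).sub (hc.comp (by fun_prop))).enorm.measurable).pow_const
          2).aemeasurable
    _ ≤ ∫⁻ z, ‖ε‖ₑ ^ 2 * ∫⁻ x, ‖fderiv ℝ f x‖ₑ ^ 2 ∂ν ∂μ := by
        refine lintegral_mono_ae (hμ.mono fun z hz => ?_)
        refine (lintegral_sq_translate_sub_le hf _).trans ?_
        gcongr
        rw [enorm_smul]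
        refine mul_le_of_le_one_right' ?_
        rw [← ofReal_norm]
        exact ENNReal.ofReal_le_one.2 hz
    _ = _ := by simp

lemma lintegral_mollify_translate_sub_sq_le {ν : Measure V} [SFinite ν] [ν.IsAddRightInvariant]
    (hf : Differentiable ℝ f) (hfc : HasCompactSupport f) (w : V) :
    ∫⁻ x, ‖mollify μ ε f (x - w) - mollify μ ε f x‖ₑ ^ 2 ∂ν ≤
      ‖w‖ₑ ^ 2 * ∫⁻ x, ‖fderiv ℝ f x‖ₑ ^ 2 ∂ν := by
  have hc := hf.continuous
  have hd : ∀ x, mollify μ ε f (x - w) - mollify μ ε f x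
      = mollify μ ε (fun y => f (y - w) - f y) x := by
    intro x
    simp only [mollify]
    rw [integral_sub _ (integrable_comp_sub_smul hc hfc ε x)]
    · simp only [sub_right_comm]
    · simpa only [sub_right_comm] using integrable_comp_sub_smul hc hfc ε (x - w)
  simp_rw [hd]
  exact (lintegral_mollify_sq_le (by fun_prop)).trans (lintegral_sq_translate_sub_le hf w)

/-- Mollification does not increase the `L²` norm of a directional derivative
beyond the `L²` norm of the full derivative. -/
lemma lintegral_fderiv_mollify_apply_sq_le {ν : Measure V} [SFinite ν] [ν.IsAddRightInvariant]
    (hf : Differentiable ℝ f) (hfc : HasCompactSupport f)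
    (hF : Differentiable ℝ (mollify μ ε f)) (v : V) :
    ∫⁻ x, ‖fderiv ℝ (mollify μ ε f) x v‖ₑ ^ 2 ∂ν ≤
      ‖v‖ₑ ^ 2 * ∫⁻ x, ‖fderiv ℝ f x‖ₑ ^ 2 ∂ν := by
  set F := mollify μ ε f
  set c : ℕ → ℝ := fun n => n + 1
  have hcpos : ∀ n, 0 < c n := fun n => by positivity
  have hlim : ∀ x, Filter.Tendsto (fun n => ‖c n • (F (x + (c n)⁻¹ • v) - F x)‖ₑ ^ 2)
      Filter.atTop (nhds (‖fderiv ℝ F x v‖ₑ ^ 2)) := by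
    intro x
    have h := (hF x).hasFDerivAt.lim v (c := c) (l := Filter.atTop) ?_
    · exact (ENNReal.continuous_pow 2).continuousAt.tendsto.comp h.enorm
    · refine tendsto_norm_atTop_atTop.comp ?_
      exact Filter.tendsto_atTop_add_const_right _ _ tendsto_natCast_atTop_atTop
  calc _ = ∫⁻ x, Filter.liminf (fun n => ‖c n • (F (x + (c n)⁻¹ • v) - F x)‖ₑ ^ 2)
        Filter.atTop ∂ν := lintegral_congr fun x => (hlim x).liminf_eq.symm
    _ ≤ Filter.liminf (fun n => ∫⁻ x, ‖c n • (F (x + (c n)⁻¹ • v) - F x)‖ₑ ^ 2 ∂ν)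
        Filter.atTop := by
        refine lintegral_liminf_le fun n => ?_
        have := hF.continuous
        exact (Continuous.enorm (by fun_prop)).measurable.pow_const 2
    _ ≤ Filter.liminf (fun _ : ℕ => ‖v‖ₑ ^ 2 * ∫⁻ x, ‖fderiv ℝ f x‖ₑ ^ 2 ∂ν) Filter.atTop := by
        refine Filter.liminf_le_liminf (Filter.Eventually.of_forall fun n => ?_)
        have h := lintegral_mollify_translate_sub_sq_le (μ := μ) (ε := ε) (ν := ν) hf hfc
          (-((c n)⁻¹ • v))
        simp only [sub_neg_eq_add, enorm_neg, enorm_smul] at h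
        simp only [smul_eq_mul, enorm_mul, mul_pow] at h ⊢
        rw [lintegral_const_mul' _ _ (by simp)]
        refine (mul_le_mul_right h _).trans_eq ?_
        have h1 : ‖c n‖ₑ ^ 2 * ‖(c n)⁻¹‖ₑ ^ 2 = 1 := by
          rw [← mul_pow, ← enorm_mul, mul_inv_cancel₀ (hcpos n).ne']
          simp
        rw [← mul_assoc, ← mul_assoc, h1, one_mul]
    _ = _ := by simp


lemma lintegral_Ioi_inv_cube_le {r : ℝ} (hr : 0 < r) :
    ∫⁻ s in Set.Ioi r, ENNReal.ofReal ((s ^ 3)⁻¹) ≤ ENNReal.ofReal ((r ^ 2)⁻¹) := by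
  have hpow : ∀ s ∈ Set.Ioi r, (s ^ 3)⁻¹ = s ^ (-3 : ℝ) := by
    intro s hs
    rw [Real.rpow_neg (hr.trans hs).le]
    norm_cast
  rw [setLIntegral_congr_fun measurableSet_Ioi (fun s hs => by rw [hpow s hs]),
    ← ofReal_integral_eq_lintegral_ofReal, integral_Ioi_rpow_of_lt (by norm_num) hr]
  · refine ENNReal.ofReal_le_ofReal ?_
    have : r ^ (-3 + 1 : ℝ) = (r ^ 2)⁻¹ := by
      rw [show (-3 + 1 : ℝ) = -2 by norm_num, Real.rpow_neg hr.le]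
      norm_cast
    rw [this, show (-3 + 1 : ℝ) = -2 by norm_num, neg_div_neg_eq]
    have : 0 < (r ^ 2)⁻¹ := by positivity
    linarith
  · exact integrableOn_Ioi_rpow_of_lt (by norm_num) hr
  · exact (ae_restrict_mem measurableSet_Ioi).mono fun s hs =>
      Real.rpow_nonneg (hr.trans hs).le _

lemma lintegral_Ioc_inv {ε : ℝ} (hε : 0 < ε) (hε1 : ε ≤ 1) :
    ∫⁻ s in Set.Ioc ε 1, ENNReal.ofReal s⁻¹ = ENNReal.ofReal |Real.log ε| := by
  have h0 : (0 : ℝ) ∉ Set.uIcc ε 1 := by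
    rw [Set.uIcc_of_le hε1]
    exact fun h => absurd h.1 (not_le.2 hε)
  rw [← ofReal_integral_eq_lintegral_ofReal, ← intervalIntegral.integral_of_le hε1,
    integral_inv h0, one_div, Real.log_inv, abs_of_nonpos (Real.log_nonpos hε.le hε1)]
  · exact (intervalIntegrable_iff_integrableOn_Ioc_of_le hε1).1
      (intervalIntegral.intervalIntegrable_inv (fun x hx h => h0 (h ▸ hx)) continuousOn_id)
  · exact (ae_restrict_mem measurableSet_Ioc).mono fun s hs => inv_nonneg.2 (hε.trans hs.1).le

lemma lintegral_comp_smul_eq (ν : Measure V) [ν.IsAddHaarMeasure] (k : V → ENNReal) {r : ℝ}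
    (hr : 0 < r) :
    ∫⁻ z, k (r • z) ∂ν = ENNReal.ofReal ((r ^ Module.finrank ℝ V)⁻¹) * ∫⁻ y, k y ∂ν := by
  have h := (Homeomorph.smulOfNeZero r hr.ne').toMeasurableEquiv.measurableEmbedding.lintegral_map
    (μ := ν) k
  have hmap : Measure.map (⇑(Homeomorph.smulOfNeZero r hr.ne').toMeasurableEquiv) ν =
      ENNReal.ofReal |(r ^ Module.finrank ℝ V)⁻¹| • ν := Measure.map_addHaar_smul ν hr.ne'
  rw [hmap, lintegral_smul_measure, abs_of_pos (by positivity)] at h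
  exact h.symm

/-- In dimension two, a weighted average over dyadic-like scales of dilated translates of an
integrable function is controlled independently of the range of scales. -/
lemma lintegral_scales_le {ν : Measure V} [ν.IsAddHaarMeasure] (hdim : Module.finrank ℝ V = 2)
    {μ : Measure V} {K : ENNReal} (hμ : μ ≤ K • ν.restrict (Metric.ball 0 1))
    {H : V → ENNReal} (hH : Measurable H) {ε : ℝ} (hε : 0 < ε) (x : V) :
    ∫⁻ s in Set.Ioc ε 1, ∫⁻ z, ENNReal.ofReal s * ‖z‖ₑ ^ 2 * H (x - s • z) ∂μ ≤
      K * ∫⁻ y, H y ∂ν := by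
  have hscale : ∀ s ∈ Set.Ioc ε 1, ∫⁻ z, ENNReal.ofReal s * ‖z‖ₑ ^ 2 * H (x - s • z) ∂μ ≤
      K * ∫⁻ y, (Set.Ioi ‖y‖).indicator (fun s => ENNReal.ofReal (s ^ 3)⁻¹) s *
        (‖y‖ₑ ^ 2 * H (x - y)) ∂ν := by
    intro s hs
    have hs0 : 0 < s := hε.trans hs.1
    refine (lintegral_mono' hμ le_rfl).trans ?_
    rw [lintegral_smul_measure, smul_eq_mul]
    refine mul_le_mul_right ?_ K
    rw [← lintegral_indicator measurableSet_ball]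
    have hpt : ∀ z, (Metric.ball (0 : V) 1).indicator
        (fun z => ENNReal.ofReal s * ‖z‖ₑ ^ 2 * H (x - s • z)) z =
        (fun y => (Set.Ioi ‖y‖).indicator (fun s => ENNReal.ofReal s⁻¹) s *
        (‖y‖ₑ ^ 2 * H (x - y))) (s • z) := by
      intro z
      have hmem : ‖s • z‖ < s ↔ ‖z‖ < 1 := by
        rw [norm_smul, Real.norm_of_nonneg hs0.le]
        exact mul_lt_iff_lt_one_right hs0
      by_cases hz : ‖z‖ < 1
      · rw [Set.indicator_of_mem (by simpa using hz)]
        simp only []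
        rw [Set.indicator_of_mem (by simpa using hmem.2 hz), enorm_smul,
          Real.enorm_of_nonneg hs0.le, mul_pow, ← mul_assoc, ← mul_assoc,
          ← ENNReal.ofReal_pow hs0.le, ← ENNReal.ofReal_mul (by positivity)]
        congr 3
        field_simp
      · rw [Set.indicator_of_notMem (by simpa using hz)]
        simp only []
        rw [Set.indicator_of_notMem (by simpa using fun h => hz (hmem.1 h)), zero_mul]
    rw [lintegral_congr hpt, lintegral_comp_smul_eq ν
        (fun y => (Set.Ioi ‖y‖).indicator (fun s => ENNReal.ofReal s⁻¹) s *
        (‖y‖ₑ ^ 2 * H (x - y))) hs0, hdim,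
      ← lintegral_const_mul' _ _ ENNReal.ofReal_ne_top]
    refine lintegral_mono fun y => ?_
    rw [← mul_assoc]
    refine mul_le_mul_left ?_ _
    by_cases hy : s ∈ Set.Ioi ‖y‖
    · rw [Set.indicator_of_mem hy, Set.indicator_of_mem hy,
        ← ENNReal.ofReal_mul (by positivity), ← mul_inv, ← pow_succ]
    · rw [Set.indicator_of_notMem hy, Set.indicator_of_notMem hy, mul_zero]
  have hmeas : Measurable (Function.uncurry fun (s : ℝ) (y : V) =>
      (Set.Ioi ‖y‖).indicator (fun s => ENNReal.ofReal (s ^ 3)⁻¹) s *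
        (‖y‖ₑ ^ 2 * H (x - y))) := by
    have h1 : Measurable ({p : ℝ × V | ‖p.2‖ < p.1}.indicator
        fun p => ENNReal.ofReal (p.1 ^ 3)⁻¹) :=
      (by fun_prop : Measurable fun p : ℝ × V => ENNReal.ofReal (p.1 ^ 3)⁻¹).indicator
        (measurableSet_lt (by fun_prop) (by fun_prop))
    refine Measurable.mul (f := {p : ℝ × V | ‖p.2‖ < p.1}.indicator
        fun p => ENNReal.ofReal (p.1 ^ 3)⁻¹) h1 ?_
    exact (measurable_snd.enorm.pow_const 2).mul (hH.comp (by fun_prop))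
  have hinner : ∀ y : V, ‖y‖ₑ ^ 2 * ∫⁻ s in Set.Ioc ε 1,
      (Set.Ioi ‖y‖).indicator (fun s => ENNReal.ofReal (s ^ 3)⁻¹) s ≤ 1 := by
    intro y
    rcases eq_or_ne y 0 with rfl | hy
    · simp
    have hy0 : 0 < ‖y‖ := norm_pos_iff.2 hy
    calc _ ≤ ‖y‖ₑ ^ 2 * ∫⁻ s in Set.Ioi ‖y‖, ENNReal.ofReal (s ^ 3)⁻¹ := by
          rw [← lintegral_indicator measurableSet_Ioi]
          exact mul_le_mul_right (lintegral_mono' Measure.restrict_le_self le_rfl) _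
      _ ≤ ‖y‖ₑ ^ 2 * ENNReal.ofReal ((‖y‖ ^ 2)⁻¹) :=
          mul_le_mul_right (lintegral_Ioi_inv_cube_le hy0) _
      _ = 1 := by
          rw [← ofReal_norm, ← ENNReal.ofReal_pow hy0.le, ← ENNReal.ofReal_mul (by positivity),
            mul_inv_cancel₀ (by positivity), ENNReal.ofReal_one]
  calc _ ≤ ∫⁻ s in Set.Ioc ε 1, K * ∫⁻ y, (Set.Ioi ‖y‖).indicator
            (fun s => ENNReal.ofReal (s ^ 3)⁻¹) s * (‖y‖ₑ ^ 2 * H (x - y)) ∂ν :=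
        setLIntegral_mono' measurableSet_Ioc hscale
    _ = K * ∫⁻ y, (∫⁻ s in Set.Ioc ε 1, (Set.Ioi ‖y‖).indicator
            (fun s => ENNReal.ofReal (s ^ 3)⁻¹) s * (‖y‖ₑ ^ 2 * H (x - y))) ∂ν := by
        rw [lintegral_const_mul _ (by exact hmeas.lintegral_prod_right'),
          lintegral_lintegral_swap hmeas.aemeasurable]
    _ ≤ K * ∫⁻ y, H (x - y) ∂ν := by
        refine mul_le_mul_right (lintegral_mono fun y => ?_) K
        rw [lintegral_mul_const _ ((by fun_prop : Measurable fun s : ℝ =>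
          ENNReal.ofReal (s ^ 3)⁻¹).indicator measurableSet_Ioi), ← mul_assoc,
          mul_comm _ (‖y‖ₑ ^ 2)]
        exact mul_le_of_le_one_left' (hinner y)
    _ = _ := by rw [lintegral_sub_left_eq_self]

/-- Mollifications at scales `ε` and `1` differ by at most `|log ε|^{1/2}` times the `L²` norm of
the derivative, in dimension two. -/
lemma enorm_mollify_sub_mollify_one_sq_le {ν : Measure V} [ν.IsAddHaarMeasure]
    (hdim : Module.finrank ℝ V = 2) {K : ENNReal}
    (hμ : μ ≤ K • ν.restrict (Metric.ball 0 1))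
    (hf : Differentiable ℝ f) (hfc : HasCompactSupport f) (hε : 0 < ε) (hε1 : ε ≤ 1) (x : V) :
    ‖mollify μ ε f x - mollify μ 1 f x‖ₑ ^ 2 ≤
      K * ENNReal.ofReal |Real.log ε| * ∫⁻ y, ‖fderiv ℝ f y‖ₑ ^ 2 ∂ν := by
  have hG : Measurable fun x => ‖fderiv ℝ f x‖ₑ := (measurable_fderiv ℝ f).enorm
  have hc := hf.continuous
  set σ : Measure ℝ := volume.restrict (Set.Ioc ε 1)
  have hu : Measurable fun p : ℝ × V =>
      ENNReal.ofReal (√p.1) * ‖p.2‖ₑ * ‖fderiv ℝ f (x - p.1 • p.2)‖ₑ :=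
    (((by fun_prop : Measurable fun p : ℝ × V => ENNReal.ofReal (√p.1))).mul
      measurable_snd.enorm).mul (hG.comp (by fun_prop))
  have hv : Measurable fun p : ℝ × V => ENNReal.ofReal (√p.1)⁻¹ := by fun_prop
  have hw : Measurable fun p : ℝ × V => ‖fderiv ℝ f (x - p.1 • p.2)‖ₑ * ‖p.2‖ₑ :=
    (hG.comp (by fun_prop)).mul measurable_snd.enorm
  have hbase : ‖mollify μ ε f x - mollify μ 1 f x‖ₑ ≤
      ∫⁻ p, (ENNReal.ofReal (√p.1) * ‖p.2‖ₑ * ‖fderiv ℝ f (x - p.1 • p.2)‖ₑ) *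
        ENNReal.ofReal (√p.1)⁻¹ ∂(σ.prod μ) := by
    calc ‖mollify μ ε f x - mollify μ 1 f x‖ₑ
        = ‖∫ z, (f (x - (1 : ℝ) • z) - f (x - ε • z)) ∂μ‖ₑ := by
          rw [integral_sub (integrable_comp_sub_smul hc hfc _ x)
            (integrable_comp_sub_smul hc hfc _ x), ← enorm_neg, neg_sub]
          rfl
      _ ≤ ∫⁻ z, (∫⁻ s in Set.Ioc ε 1, ‖fderiv ℝ f (x - s • z)‖ₑ * ‖z‖ₑ) ∂μ :=
          (enorm_integral_le_lintegral_enorm _).trans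
            (lintegral_mono fun z => enorm_sub_le_lintegral_fderiv hf x z hε1)
      _ = ∫⁻ s in Set.Ioc ε 1, ∫⁻ z, ‖fderiv ℝ f (x - s • z)‖ₑ * ‖z‖ₑ ∂μ :=
          (lintegral_lintegral_swap hw.aemeasurable).symm
      _ = ∫⁻ s in Set.Ioc ε 1, ∫⁻ z, (ENNReal.ofReal (√s) * ‖z‖ₑ *
            ‖fderiv ℝ f (x - s • z)‖ₑ) * ENNReal.ofReal (√s)⁻¹ ∂μ := by
          refine setLIntegral_congr_fun measurableSet_Ioc fun s hs => lintegral_congr fun z => ?_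
          have hs0 : 0 < √s := Real.sqrt_pos.2 (hε.trans hs.1)
          have h1 : ENNReal.ofReal (√s) * ENNReal.ofReal (√s)⁻¹ = 1 := by
            rw [← ENNReal.ofReal_mul hs0.le, mul_inv_cancel₀ hs0.ne', ENNReal.ofReal_one]
          calc _ = (ENNReal.ofReal (√s) * ENNReal.ofReal (√s)⁻¹) *
                (‖fderiv ℝ f (x - s • z)‖ₑ * ‖z‖ₑ) := by rw [h1, one_mul]
            _ = _ := by ring
      _ = _ := (lintegral_prod _ (hu.mul hv).aemeasurable).symm
  have hP : ∫⁻ p, (ENNReal.ofReal (√p.1) * ‖p.2‖ₑ * ‖fderiv ℝ f (x - p.1 • p.2)‖ₑ) ^ 2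
      ∂(σ.prod μ) ≤ K * ∫⁻ y, ‖fderiv ℝ f y‖ₑ ^ 2 ∂ν := by
    rw [lintegral_prod _ (hu.pow_const 2).aemeasurable]
    refine le_trans (le_of_eq ?_)
      (lintegral_scales_le hdim hμ (hG.pow_const 2) hε x)
    refine setLIntegral_congr_fun measurableSet_Ioc fun s hs => lintegral_congr fun z => ?_
    simp only [mul_pow]
    rw [← ENNReal.ofReal_pow (Real.sqrt_nonneg _), Real.sq_sqrt (hε.trans hs.1).le]
  have hQ : ∫⁻ p, ENNReal.ofReal (√p.1)⁻¹ ^ 2 ∂(σ.prod μ) = ENNReal.ofReal |Real.log ε| := by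
    rw [lintegral_prod _ (hv.pow_const 2).aemeasurable, ← lintegral_Ioc_inv hε hε1]
    refine setLIntegral_congr_fun measurableSet_Ioc fun s hs => ?_
    simp only [lintegral_const, measure_univ, mul_one]
    rw [← ENNReal.ofReal_pow (by positivity), inv_pow, Real.sq_sqrt (hε.trans hs.1).le]
  calc _ ≤ (∫⁻ p, (ENNReal.ofReal (√p.1) * ‖p.2‖ₑ * ‖fderiv ℝ f (x - p.1 • p.2)‖ₑ) *
        ENNReal.ofReal (√p.1)⁻¹ ∂(σ.prod μ)) ^ 2 := pow_le_pow_left' hbase 2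
    _ ≤ _ := ENNReal.sq_lintegral_mul_le _ hu.aemeasurable hv.aemeasurable
    _ ≤ (K * ∫⁻ y, ‖fderiv ℝ f y‖ₑ ^ 2 ∂ν) * ENNReal.ofReal |Real.log ε| := by
        rw [hQ]
        exact mul_le_mul_left hP _
    _ = _ := by ring

lemma enorm_mollify_one_sq_le {ν : Measure V} [ν.IsAddHaarMeasure] {K : ENNReal}
    (hμ : μ ≤ K • ν.restrict (Metric.ball 0 1)) (hf : Continuous f) (x : V) :
    ‖mollify μ 1 f x‖ₑ ^ 2 ≤ K * ∫⁻ y, ‖f y‖ₑ ^ 2 ∂ν := by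
  refine (enorm_mollify_sq_le hf x).trans ?_
  have hμ' : μ ≤ K • ν := hμ.trans (by gcongr; exact Measure.restrict_le_self)
  refine (lintegral_mono' hμ' le_rfl).trans_eq ?_
  simp [lintegral_sub_left_eq_self (fun y => ‖f y‖ₑ ^ 2)]


variable (V) in
/-- There are probability measures with bounded density on the unit ball for which mollification
of continuous functions is smooth. -/
lemma exists_smooth_mollifier (ν : Measure V) [ν.IsAddHaarMeasure] :
    ∃ (μ : Measure V) (k : ℝ), IsProbabilityMeasure μ ∧ 0 < k ∧
      μ ≤ ENNReal.ofReal k • ν.restrict (Metric.ball 0 1) ∧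
      ∀ (f : V → ℝ) (ε : ℝ), Continuous f → 0 < ε →
        ContDiff ℝ (⊤ : ℕ∞) (mollify μ ε f) ∧
        (HasCompactSupport f → HasCompactSupport (mollify μ ε f)) := by
  let b : ContDiffBump (0 : V) := ⟨1 / 2, 1, by norm_num, by norm_num⟩
  set ρ : V → ℝ := b.normed ν with hρ
  have hρc : Continuous ρ := b.continuous_normed
  have hρ0 : ∀ z, 0 ≤ ρ z := fun z => b.nonneg_normed z
  have hρs : HasCompactSupport ρ := b.hasCompactSupport_normed
  obtain ⟨k, hk⟩ := hρc.bounded_above_of_compact_support hρs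
  have hmeas : Measurable fun z => ENNReal.ofReal (ρ z) := hρc.measurable.ennreal_ofReal
  refine ⟨ν.withDensity fun z => ENNReal.ofReal (ρ z), max k 1, ⟨?_⟩, by positivity, ?_, ?_⟩
  · rw [withDensity_apply _ MeasurableSet.univ, Measure.restrict_univ,
      ← ofReal_integral_eq_lintegral_ofReal b.integrable_normed (ae_of_all _ hρ0),
      b.integral_normed, ENNReal.ofReal_one]
  · rw [← withDensity_const, ← withDensity_indicator measurableSet_ball]
    refine withDensity_mono (ae_of_all _ fun z => ?_)
    by_cases hz : z ∈ Metric.ball (0 : V) 1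
    · simp only [Set.indicator_of_mem hz]
      exact ENNReal.ofReal_le_ofReal (((le_abs_self _).trans (hk z)).trans (le_max_left _ _))
    · have : ρ z = 0 := by
        rw [← Function.notMem_support, hρ, b.support_normed_eq]
        exact hz
      simp [this]
  · intro f ε hf hε
    set κ : V → ℝ := fun t => (ε ^ Module.finrank ℝ V)⁻¹ * ρ (ε⁻¹ • t) with hκ
    have hκs : HasCompactSupport κ :=
      (hρs.comp_smul (inv_ne_zero hε.ne')).mul_left
    have hκd : ContDiff ℝ (⊤ : ℕ∞) κ :=
      contDiff_const.mul (b.contDiff_normed.comp (contDiff_const_smul _))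
    have heq : mollify (ν.withDensity fun z => ENNReal.ofReal (ρ z)) ε f =
        convolution κ f (ContinuousLinearMap.lsmul ℝ ℝ) ν := by
      funext x
      rw [mollify, integral_withDensity_eq_integral_toReal_smul hmeas
        (ae_of_all _ fun _ => ENNReal.ofReal_lt_top), convolution_lsmul]
      have h := Measure.integral_comp_smul ν (fun t => ρ (ε⁻¹ • t) * f (x - t)) ε
      rw [abs_of_pos (by positivity), smul_eq_mul, ← integral_const_mul] at h
      simp only [smul_smul, inv_mul_cancel₀ hε.ne', one_smul] at h
      simp only [ENNReal.toReal_ofReal (hρ0 _), smul_eq_mul, hκ, mul_assoc]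
      exact h
    rw [heq]
    exact ⟨hκs.contDiff_convolution_left _ hκd hf.locallyIntegrable,
      fun hfs => hκs.convolution _ hfs⟩

end Mollify

lemma abs_integral_le_of_lintegral_enorm_le {α : Type*} [MeasurableSpace α] {μ : Measure α}
    {u : α → ℝ} {c : ℝ} (hc : 0 ≤ c) (h : ∫⁻ x, ‖u x‖ₑ ∂μ ≤ ENNReal.ofReal c) :
    |∫ x, u x ∂μ| ≤ c := by
  have h1 := (enorm_integral_le_lintegral_enorm u).trans h
  rwa [← ofReal_norm, ENNReal.ofReal_le_ofReal_iff hc] at h1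

lemma EuclideanSpace.norm_gradient_sq_eq {n : ℕ} (φ : EuclideanSpace ℝ (Fin n) → ℝ)
    (x : EuclideanSpace ℝ (Fin n)) :
    ‖gradient φ x‖ ^ 2 = ∑ i, (fderiv ℝ φ x (EuclideanSpace.single i 1)) ^ 2 := by
  rw [EuclideanSpace.norm_sq_eq]
  refine Finset.sum_congr rfl fun i _ => ?_
  have : fderiv ℝ φ x (EuclideanSpace.single i 1) = gradient φ x i := by
    rw [← InnerProductSpace.toDual_symm_apply (𝕜 := ℝ), EuclideanSpace.inner_single_right]
    simp [gradient]
  rw [this, Real.norm_eq_abs, sq_abs]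

lemma integral_norm_gradient_sq_le {n : ℕ} {F : EuclideanSpace ℝ (Fin n) → ℝ} {S B : ℝ}
    (hF : ContDiff ℝ 1 F) (hS : ∀ x, F x ^ 2 ≤ S) (hS0 : 0 ≤ S) (hB : 0 ≤ B)
    (hD : ∀ i, ∫⁻ x, ‖fderiv ℝ F x (EuclideanSpace.single i 1)‖ₑ ^ 2 ≤ ENNReal.ofReal B) :
    ∫ x, ‖gradient (fun y => F y ^ 2) x‖ ^ 2 ≤ 4 * S * (n * B) := by
  have hd := hF.differentiable (by norm_num)
  refine (le_abs_self _).trans (abs_integral_le_of_lintegral_enorm_le (by positivity) ?_)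
  have hpt : ∀ x, ‖‖gradient (fun y => F y ^ 2) x‖ ^ 2‖ₑ ≤ ENNReal.ofReal (4 * S) *
      ∑ i, ‖fderiv ℝ F x (EuclideanSpace.single i 1)‖ₑ ^ 2 := by
    intro x
    have hg : ‖gradient (fun y => F y ^ 2) x‖ ^ 2 ≤
        4 * S * ∑ i, fderiv ℝ F x (EuclideanSpace.single i 1) ^ 2 := by
      rw [EuclideanSpace.norm_gradient_sq_eq, Finset.mul_sum]
      refine Finset.sum_le_sum fun i _ => ?_
      rw [fderiv_fun_pow 2 (hd x)]
      simp only [Nat.add_one_sub_one, pow_one, nsmul_eq_mul, Nat.cast_ofNat,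
        _root_.smul_apply, smul_eq_mul]
      rw [mul_pow, mul_pow]
      have := hS x
      gcongr
      linarith
    rw [Real.enorm_of_nonneg (by positivity)]
    refine (ENNReal.ofReal_le_ofReal hg).trans_eq ?_
    rw [ENNReal.ofReal_mul (by positivity), ENNReal.ofReal_sum_of_nonneg fun _ _ => sq_nonneg _]
    simp_rw [Real.enorm_sq_eq_ofReal_sq]
  refine (lintegral_mono hpt).trans ?_
  have hc := hF.continuous_fderiv (by norm_num)
  rw [lintegral_const_mul' _ _ ENNReal.ofReal_ne_top, lintegral_finsetSum _ fun i _ =>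
    ((Continuous.enorm (by fun_prop)).measurable.pow_const 2),
    ENNReal.ofReal_mul (p := 4 * S) (by positivity)]
  refine mul_le_mul_right ((Finset.sum_le_sum fun i _ => hD i).trans_eq ?_) _
  rw [Finset.sum_const, Finset.card_univ, Fintype.card_fin, nsmul_eq_mul,
    ENNReal.ofReal_mul (by positivity), ENNReal.ofReal_natCast]


section Estimates

variable {V : Type*} [NormedAddCommGroup V] [NormedSpace ℝ V] [MeasurableSpace V] [BorelSpace V]
  [FiniteDimensional ℝ V] {ν μ : Measure V} [IsProbabilityMeasure μ] {f : V → ℝ} {A ε : ℝ}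

lemma mollify_sq_le [ν.IsAddHaarMeasure] (hdim : Module.finrank ℝ V = 2) {k : ℝ} (hk : 0 < k)
    (hμ : μ ≤ ENNReal.ofReal k • ν.restrict (Metric.ball 0 1)) (hf : Differentiable ℝ f)
    (hfc : HasCompactSupport f) (hA : 0 ≤ A) (hfA : ∫⁻ x, ‖f x‖ₑ ^ 2 ∂ν ≤ ENNReal.ofReal A)
    (hdA : ∫⁻ x, ‖fderiv ℝ f x‖ₑ ^ 2 ∂ν ≤ ENNReal.ofReal A) (hε : 0 < ε) (hε2 : ε ≤ 1 / 2)
    (x : V) : mollify μ ε f x ^ 2 ≤ 6 * k * |Real.log ε| * A := by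
  have hL1 : 1 ≤ 2 * |Real.log ε| := by
    have h1 : Real.log ε ≤ Real.log (1 / 2) := Real.log_le_log hε hε2
    rw [one_div, Real.log_inv] at h1
    have := Real.log_two_gt_d9
    have := neg_le_abs (Real.log ε)
    linarith
  have h1 := (enorm_mollify_one_sq_le hμ hf.continuous x).trans (mul_le_mul_right hfA _)
  have h2 := (enorm_mollify_sub_mollify_one_sq_le hdim hμ hf hfc hε (by linarith) x).trans
    (mul_le_mul_right hdA _)
  rw [← ENNReal.ofReal_mul hk.le, Real.enorm_sq_eq_ofReal_sq,
    ENNReal.ofReal_le_ofReal_iff (by positivity)] at h1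
  rw [← ENNReal.ofReal_mul hk.le, ← ENNReal.ofReal_mul (by positivity),
    Real.enorm_sq_eq_ofReal_sq, ENNReal.ofReal_le_ofReal_iff (by positivity)] at h2
  have h3 : k * A ≤ k * A * (2 * |Real.log ε|) := le_mul_of_one_le_right (by positivity) hL1
  nlinarith [sq_nonneg (mollify μ ε f x - mollify μ 1 f x - mollify μ 1 f x)]

lemma lintegral_mollify_sub_mul_add_le [SFinite ν] [ν.IsAddRightInvariant]
    (hμ1 : ∀ᵐ z ∂μ, ‖z‖ ≤ 1) (hf : Differentiable ℝ f) (hfc : HasCompactSupport f)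
    (hF : Continuous (mollify μ ε f)) (hA : 0 ≤ A)
    (hfA : ∫⁻ x, ‖f x‖ₑ ^ 2 ∂ν ≤ ENNReal.ofReal A)
    (hdA : ∫⁻ x, ‖fderiv ℝ f x‖ₑ ^ 2 ∂ν ≤ ENNReal.ofReal A) (hε : 0 < ε) :
    ∫⁻ x, ‖mollify μ ε f x - f x‖ₑ * ‖f x + mollify μ ε f x‖ₑ ∂ν ≤
      ENNReal.ofReal (2 * ε * A) := by
  have hcf := hf.continuous
  set F := mollify μ ε f
  rw [← ENNReal.pow_le_pow_left_iff two_ne_zero]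
  have hsum : ∫⁻ x, ‖f x + F x‖ₑ ^ 2 ∂ν ≤ ENNReal.ofReal (4 * A) := by
    calc _ ≤ ∫⁻ x, 2 * (‖f x‖ₑ ^ 2 + ‖F x‖ₑ ^ 2) ∂ν := lintegral_mono fun x =>
          (pow_le_pow_left' (enorm_add_le _ _) 2).trans (ENNReal.add_sq_le_two_mul _ _)
      _ = 2 * (∫⁻ x, ‖f x‖ₑ ^ 2 ∂ν + ∫⁻ x, ‖F x‖ₑ ^ 2 ∂ν) := by
          rw [lintegral_const_mul' _ _ (by simp),
            lintegral_add_left (hcf.enorm.measurable.pow_const 2)]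
      _ ≤ 2 * (ENNReal.ofReal A + ENNReal.ofReal A) := by
          gcongr
          exact (lintegral_mollify_sq_le hcf).trans hfA
      _ = _ := by
          rw [← ENNReal.ofReal_add hA hA, ← ENNReal.ofReal_ofNat 2,
            ← ENNReal.ofReal_mul (by norm_num)]
          congr 1
          ring
  calc _ ≤ (∫⁻ x, ‖F x - f x‖ₑ ^ 2 ∂ν) * ∫⁻ x, ‖f x + F x‖ₑ ^ 2 ∂ν :=
        ENNReal.sq_lintegral_mul_le _ (hF.sub hcf).enorm.measurable.aemeasurable
          (hcf.add hF).enorm.measurable.aemeasurable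
    _ ≤ (‖ε‖ₑ ^ 2 * ENNReal.ofReal A) * ENNReal.ofReal (4 * A) := by
        gcongr
        exact (lintegral_mollify_sub_sq_le hf hfc hμ1).trans (mul_le_mul_right hdA _)
    _ = _ := by
        rw [Real.enorm_sq_eq_ofReal_sq, ← ENNReal.ofReal_mul (by positivity),
          ← ENNReal.ofReal_mul (by positivity), ← ENNReal.ofReal_pow (by positivity)]
        congr 1
        ring

lemma abs_integral_mul_sq_sub_mollify_sq_le [SFinite ν] [ν.IsAddRightInvariant]
    (hμ1 : ∀ᵐ z ∂μ, ‖z‖ ≤ 1) (hf : Differentiable ℝ f) (hfc : HasCompactSupport f)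
    (hF : Continuous (mollify μ ε f)) (hA : 0 ≤ A)
    (hfA : ∫⁻ x, ‖f x‖ₑ ^ 2 ∂ν ≤ ENNReal.ofReal A)
    (hdA : ∫⁻ x, ‖fderiv ℝ f x‖ₑ ^ 2 ∂ν ≤ ENNReal.ofReal A) {g : V → ℝ} {M : ℝ}
    (hgM : ∀ x, |g x| ≤ M) (hM : 0 ≤ M) (hε : 0 < ε) :
    |∫ x, g x * (f x ^ 2 - mollify μ ε f x ^ 2) ∂ν| ≤ M * (2 * ε * A) := by
  refine abs_integral_le_of_lintegral_enorm_le (by positivity) ?_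
  set F := mollify μ ε f
  have hpt : ∀ x, ‖g x * (f x ^ 2 - F x ^ 2)‖ₑ ≤
      ENNReal.ofReal M * (‖F x - f x‖ₑ * ‖f x + F x‖ₑ) := by
    intro x
    rw [enorm_mul, ← enorm_neg (f x ^ 2 - F x ^ 2),
      show -(f x ^ 2 - F x ^ 2) = (F x - f x) * (f x + F x) by ring, enorm_mul,
      ← ofReal_norm (g x)]
    exact mul_le_mul_left (ENNReal.ofReal_le_ofReal (hgM x)) _
  refine (lintegral_mono hpt).trans ?_
  rw [lintegral_const_mul' _ _ ENNReal.ofReal_ne_top, ENNReal.ofReal_mul hM]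
  exact mul_le_mul_right
    (lintegral_mollify_sub_mul_add_le hμ1 hf hfc hF hA hfA hdA hε) _

end Estimates

lemma integrable_mul_sq_of_hasCompactSupport {X : Type*} [TopologicalSpace X] [MeasurableSpace X]
    [OpensMeasurableSpace X] {ν : Measure X} [IsFiniteMeasureOnCompacts ν] {g u : X → ℝ} {M : ℝ}
    (hg : Measurable g) (hgM : ∀ x, |g x| ≤ M) (hu : Continuous u) (huc : HasCompactSupport u) :
    Integrable (fun x => g x * u x ^ 2) ν := by
  have hsq : HasCompactSupport fun x => u x ^ 2 :=
    huc.comp_left (g := fun t : ℝ => t ^ 2) (by simp)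
  have hint : Integrable (fun x => u x ^ 2) ν := (hu.pow 2).integrable_of_hasCompactSupport hsq
  exact hint.bdd_mul (c := M) hg.aestronglyMeasurable (ae_of_all _ hgM)

lemma trilinear_estimate_of_hasCompactSupport :
    ∃ C > 0, ∀ (f g : EuclideanSpace ℝ (Fin 2) → ℝ) (M N A ε : ℝ),
      Differentiable ℝ f → HasCompactSupport f → 0 ≤ A →
      ∫⁻ x, ‖f x‖ₑ ^ 2 ≤ ENNReal.ofReal A → ∫⁻ x, ‖fderiv ℝ f x‖ₑ ^ 2 ≤ ENNReal.ofReal A →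
      Measurable g → (∀ x, |g x| ≤ M) →
      (∀ h : EuclideanSpace ℝ (Fin 2) → ℝ, ContDiff ℝ (⊤ : ℕ∞) h → HasCompactSupport h →
        |∫ x, g x * h x| ≤ N * √(∫ x, ‖gradient h x‖ ^ 2)) →
      0 ≤ N → 0 < ε → ε ≤ 1 / 2 →
        |∫ x, g x * (f x) ^ 2| ≤ C * (N * √|Real.log ε| + ε * M) * A := by
  obtain ⟨μ, k, hμp, hk, hμ, hmol⟩ :=
    exists_smooth_mollifier (EuclideanSpace ℝ (Fin 2)) volume
  refine ⟨√(48 * k) + 2, by positivity, ?_⟩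
  intro f g M N A ε hf hfc hA hfA hdA hg hgM hdual hN hε hε2
  have hdim : Module.finrank ℝ (EuclideanSpace ℝ (Fin 2)) = 2 := by simp
  have hM : 0 ≤ M := (abs_nonneg _).trans (hgM 0)
  have hμ1 : ∀ᵐ z ∂μ, ‖z‖ ≤ 1 := by
    have h1 : ∀ᵐ z ∂(volume.restrict (Metric.ball (0 : EuclideanSpace ℝ (Fin 2)) 1)), ‖z‖ ≤ 1 :=
      (ae_restrict_mem measurableSet_ball).mono fun z hz => by
        simpa using (Metric.mem_ball.1 hz).le
    exact ae_mono hμ (Measure.ae_smul_measure h1 _)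
  have hcf := hf.continuous
  obtain ⟨hFd, hFs⟩ := hmol f ε hcf hε
  have hFc := hFs hfc
  set F := mollify μ ε f
  have hF : Continuous F := hFd.continuous
  set L := |Real.log ε|
  have hsup : ∀ x, F x ^ 2 ≤ 6 * k * L * A :=
    mollify_sq_le hdim hk hμ hf hfc hA hfA hdA hε hε2
  have hgrad : ∫ x, ‖gradient (fun y => F y ^ 2) x‖ ^ 2 ≤ 48 * k * L * A ^ 2 := by
    refine (integral_norm_gradient_sq_le (hFd.of_le (by exact_mod_cast le_top)) hsup
      (by positivity) hA fun i => ?_).trans_eq (by push_cast; ring)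
    refine (lintegral_fderiv_mollify_apply_sq_le hf hfc
      (hFd.differentiable (by simp)) _).trans ?_
    simpa [← ofReal_norm] using hdA
  have hmain : |∫ x, g x * F x ^ 2| ≤ N * (√(48 * k) * √L * A) := by
    refine (hdual _ (hFd.pow 2) (hFc.comp_left (g := fun t : ℝ => t ^ 2) (by simp))).trans ?_
    refine mul_le_mul_of_nonneg_left ((Real.sqrt_le_sqrt hgrad).trans_eq ?_) hN
    rw [Real.sqrt_mul (by positivity), Real.sqrt_mul (by positivity), Real.sqrt_sq hA]
  have hdiff : |∫ x, g x * (f x ^ 2 - F x ^ 2)| ≤ M * (2 * ε * A) :=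
    abs_integral_mul_sq_sub_mollify_sq_le hμ1 hf hfc hF hA hfA hdA hgM hM hε
  have hsplit : ∫ x, g x * f x ^ 2 =
      (∫ x, g x * F x ^ 2) + ∫ x, g x * (f x ^ 2 - F x ^ 2) := by
    simp_rw [mul_sub]
    rw [integral_sub (integrable_mul_sq_of_hasCompactSupport hg hgM hcf hfc)
      (integrable_mul_sq_of_hasCompactSupport hg hgM hF hFc)]
    ring
  rw [hsplit]
  refine (abs_add_le _ _).trans ((add_le_add hmain hdiff).trans ?_)
  have h1 : 0 ≤ N * √L * A := by positivity
  have h2 : 0 ≤ √(48 * k) * (ε * M * A) := by positivity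
  nlinarith

/-- Smooth cutoffs at scale `n + 1`, with derivatives bounded uniformly in `n`. -/
lemma exists_cutoff (V : Type*) [NormedAddCommGroup V] [NormedSpace ℝ V] [FiniteDimensional ℝ V] :
    ∃ (χ : ℕ → V → ℝ) (D : ℝ), 0 ≤ D ∧ ∀ n, Differentiable ℝ (χ n) ∧ HasCompactSupport (χ n) ∧
      (∀ x, |χ n x| ≤ 1) ∧ (∀ x, ‖fderiv ℝ (χ n) x‖ ≤ D) ∧
      ∀ x, Filter.Tendsto (fun n => χ n x) Filter.atTop (nhds 1) := by
  let b : ContDiffBump (0 : V) := ⟨1, 2, by norm_num, by norm_num⟩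
  have hb : ContDiff ℝ 1 b := b.contDiff
  obtain ⟨D, hD⟩ := (hb.continuous_fderiv (by norm_num)).bounded_above_of_compact_support
    (b.hasCompactSupport.fderiv ℝ)
  have hD0 : 0 ≤ D := (norm_nonneg _).trans (hD 0)
  have hbd : Differentiable ℝ b := hb.differentiable (by norm_num)
  refine ⟨fun n x => b (((n : ℝ) + 1)⁻¹ • x), D, hD0, fun n => ⟨?_, ?_, ?_, ?_, ?_⟩⟩
  · exact hbd.comp (differentiable_id.const_smul _)
  · exact b.hasCompactSupport.comp_smul (by positivity)
  · intro x
    rw [abs_of_nonneg b.nonneg]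
    exact b.le_one
  · intro x
    have h := fderiv_comp_smul (𝕜 := ℝ) (f := b) (c := ((n : ℝ) + 1)⁻¹) (x := x)
    rw [h, norm_smul]
    have h1 : ‖((n : ℝ) + 1)⁻¹‖ ≤ 1 := by
      rw [Real.norm_of_nonneg (by positivity)]
      exact inv_le_one_of_one_le₀ (by linarith [n.cast_nonneg (α := ℝ)])
    exact (mul_le_of_le_one_left (norm_nonneg _) h1).trans (hD _)
  · intro x
    have h : Filter.Tendsto (fun n : ℕ => ((n : ℝ) + 1)⁻¹ • x) Filter.atTop (nhds 0) := by
      have := (tendsto_one_div_add_atTop_nhds_zero_nat (𝕜 := ℝ)).smul_const x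
      simpa using this
    have h1 := (hb.continuous.tendsto 0).comp h
    have h2 : b 0 = 1 := b.one_of_mem_closedBall (Metric.mem_closedBall_self zero_le_one)
    rwa [h2] at h1

lemma lintegral_fderiv_mul_sq_le {V : Type*} [NormedAddCommGroup V] [NormedSpace ℝ V]
    [MeasurableSpace V] [BorelSpace V] {ν : Measure V} {χ f : V → ℝ} {D : ℝ}
    (hχ : Differentiable ℝ χ) (hχ1 : ∀ x, |χ x| ≤ 1) (hχD : ∀ x, ‖fderiv ℝ χ x‖ ≤ D)
    (hf : Differentiable ℝ f) :
    ∫⁻ x, ‖fderiv ℝ (fun y => χ y * f y) x‖ₑ ^ 2 ∂ν ≤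
      2 * (∫⁻ x, ‖fderiv ℝ f x‖ₑ ^ 2 ∂ν +
        ENNReal.ofReal (D ^ 2) * ∫⁻ x, ‖f x‖ₑ ^ 2 ∂ν) := by
  rw [← lintegral_const_mul' _ _ ENNReal.ofReal_ne_top,
    ← lintegral_add_left ((measurable_fderiv ℝ f).enorm.pow_const 2),
    ← lintegral_const_mul' _ _ (by simp)]
  refine lintegral_mono fun x => ?_
  have hD : 0 ≤ D := (norm_nonneg _).trans (hχD x)
  rw [fderiv_fun_mul (hχ x) (hf x)]
  refine (pow_le_pow_left' (enorm_add_le (χ x • fderiv ℝ f x) (f x • fderiv ℝ χ x)) 2).trans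
    ((ENNReal.add_sq_le_two_mul _ _).trans ?_)
  rw [enorm_smul, enorm_smul, mul_pow, mul_pow, mul_comm (‖f x‖ₑ ^ 2)]
  gcongr
  · refine mul_le_of_le_one_left' (pow_le_one' ?_ 2)
    rw [← ofReal_norm]
    exact ENNReal.ofReal_le_one.2 (hχ1 x)
  · rw [ENNReal.ofReal_pow hD, ← ofReal_norm]
    exact pow_le_pow_left' (ENNReal.ofReal_le_ofReal (hχD x)) 2

/-- Trilinear estimate: if `‖g‖_{Ḣ⁻¹} ≤ N ≤ 1/2` (expressed by duality against smooth
compactly supported test functions), `|g| ≤ M` a.e., and `f ∈ H¹(ℝ²)`, then for every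
`ε ∈ (0,1/2]`, `|∫ g f²| ≤ C(N |ln ε|^{1/2} + ε M) ‖f‖²_{H¹}`. -/
theorem trilinear_bubble_estimate :
    ∃ C > 0, ∀ (f g : EuclideanSpace ℝ (Fin 2) → ℝ) (M N : ℝ),
      Differentiable ℝ f →
      Integrable (fun x => (f x) ^ 2) →
      Integrable (fun x => ‖fderiv ℝ f x‖ ^ 2) →
      Measurable g → (∀ x, |g x| ≤ M) →
      (∀ h : EuclideanSpace ℝ (Fin 2) → ℝ, ContDiff ℝ (⊤ : ℕ∞) h → HasCompactSupport h →
        |∫ x, g x * h x| ≤ N * Real.sqrt (∫ x, ‖gradient h x‖ ^ 2)) →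
      0 ≤ N → N ≤ 1 / 2 →
      ∀ ε : ℝ, 0 < ε → ε ≤ 1 / 2 →
        |∫ x, g x * (f x) ^ 2|
          ≤ C * (N * Real.sqrt |Real.log ε| + ε * M) *
              ((∫ x, (f x) ^ 2) + ∫ x, ‖fderiv ℝ f x‖ ^ 2) := by
  obtain ⟨C, hC, hest⟩ := trilinear_estimate_of_hasCompactSupport
  obtain ⟨χ, D, hD, hχ⟩ := exists_cutoff (EuclideanSpace ℝ (Fin 2))
  refine ⟨C * (2 * (1 + D ^ 2)), by positivity, ?_⟩
  intro f g M N hf hf2 hdf2 hg hgM hdual hN _ ε hε hε2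
  set a := ∫ x, f x ^ 2 with ha
  set b := ∫ x, ‖fderiv ℝ f x‖ ^ 2 with hb
  have ha0 : 0 ≤ a := integral_nonneg fun x => sq_nonneg _
  have hb0 : 0 ≤ b := integral_nonneg fun x => sq_nonneg _
  have hfa : ∫⁻ x, ‖f x‖ₑ ^ 2 = ENNReal.ofReal a := by
    rw [ha, ofReal_integral_eq_lintegral_ofReal hf2 (ae_of_all _ fun x => sq_nonneg _)]
    simp_rw [Real.enorm_sq_eq_ofReal_sq]
  have hfb : ∫⁻ x, ‖fderiv ℝ f x‖ₑ ^ 2 = ENNReal.ofReal b := by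
    rw [hb, ofReal_integral_eq_lintegral_ofReal hdf2 (ae_of_all _ fun x => sq_nonneg _)]
    simp_rw [← ofReal_norm, ← ENNReal.ofReal_pow (norm_nonneg _)]
  have hle : ∀ n x, (χ n x * f x) ^ 2 ≤ f x ^ 2 := fun n x => by
    rw [mul_pow]
    exact mul_le_of_le_one_left (sq_nonneg _) ((sq_le_one_iff_abs_le_one _).2 ((hχ n).2.2.1 x))
  have hlim : Filter.Tendsto (fun n => ∫ x, g x * (χ n x * f x) ^ 2) Filter.atTop
      (nhds (∫ x, g x * f x ^ 2)) := by
    refine tendsto_integral_of_dominated_convergence (fun x => M * f x ^ 2) (fun n => ?_)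
      (hf2.const_mul M) (fun n => ae_of_all _ fun x => ?_) (ae_of_all _ fun x => ?_)
    · have h1 := (hχ n).1.continuous
      have h2 := hf.continuous
      have h3 : Continuous fun x => (χ n x * f x) ^ 2 := by fun_prop
      exact (hg.mul h3.measurable).aestronglyMeasurable
    · rw [norm_mul, Real.norm_of_nonneg (sq_nonneg _)]
      exact mul_le_mul (hgM x) (hle n x) (sq_nonneg _) ((abs_nonneg _).trans (hgM x))
    · simpa using ((((hχ 0).2.2.2.2 x).mul_const (f x)).pow 2).const_mul (g x)
  refine le_of_tendsto hlim.abs (Filter.Eventually.of_forall fun n => ?_)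
  obtain ⟨hχd, hχs, hχ1, hχD, -⟩ := hχ n
  refine (hest (fun x => χ n x * f x) g M N (2 * (1 + D ^ 2) * (a + b)) ε (hχd.mul hf)
    hχs.mul_right (by positivity) ?_ ?_ hg hgM hdual hN hε hε2).trans_eq (by ring)
  · calc _ ≤ ∫⁻ x, ‖f x‖ₑ ^ 2 := by
          refine lintegral_mono fun x => ?_
          rw [Real.enorm_sq_eq_ofReal_sq, Real.enorm_sq_eq_ofReal_sq]
          exact ENNReal.ofReal_le_ofReal (hle n x)
      _ ≤ _ := by
          rw [hfa]
          refine ENNReal.ofReal_le_ofReal ?_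
          nlinarith [mul_nonneg (sq_nonneg D) ha0, mul_nonneg (sq_nonneg D) hb0]
  · refine (lintegral_fderiv_mul_sq_le hχd hχ1 hχD hf).trans ?_
    rw [hfa, hfb, ← ENNReal.ofReal_mul (by positivity),
      ← ENNReal.ofReal_add hb0 (by positivity), ← ENNReal.ofReal_ofNat 2,
      ← ENNReal.ofReal_mul (by norm_num)]
    refine ENNReal.ofReal_le_ofReal ?_
    nlinarith [mul_nonneg (sq_nonneg D) hb0]
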